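/- If n is prime and ZM(m,n,r) is a ZM-group, then csd(ZM(m,n,r)) = (τ(m)(τ(m)+m) + m(τ(m)+1)) / (τ(m)+m)². -/

import Mathlib

open Pointwise

/-- The relators of the Zassenhaus metacyclic group
`ZM(m,n,r) = ⟨a, b | a^m = b^n = 1, b⁻¹ab = a^r⟩`. -/
def ZMrel (m n r : ℕ) : Set (FreeGroup (Fin 2)) :=
  {FreeGroup.of 0 ^ m, FreeGroup.of 1 ^ n,
   (FreeGroup.of 1)⁻¹ * FreeGroup.of 0 * FreeGroup.of 1 * (FreeGroup.of 0 ^ r)⁻¹}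

/-- The ZM-group `ZM(m,n,r)` as a presented group. -/
abbrev ZM (m n r : ℕ) : Type := PresentedGroup (ZMrel m n r)

/-- The generator `a` of `ZM(m,n,r)`. -/
def za (m n r : ℕ) : ZM m n r := PresentedGroup.of 0

/-- The generator `b` of `ZM(m,n,r)`. -/
def zb (m n r : ℕ) : ZM m n r := PresentedGroup.of 1

section CyclicSubgroups

variable {G : Type*} [Group G]

lemma Subgroup.zpowers_pow_gcd_orderOf (a : G) (k : ℕ) :
    zpowers (a ^ Nat.gcd (orderOf a) k) = zpowers (a ^ k) := by
  apply le_antisymm <;> rw [zpowers_le]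
  · refine ⟨Nat.gcdB (orderOf a) k, ?_⟩
    have := Nat.gcd_eq_gcd_ab (orderOf a) k
    change (a ^ k) ^ _ = _
    rw [← zpow_natCast a (Nat.gcd _ _), this, zpow_add, zpow_mul, zpow_natCast, pow_orderOf_eq_one,
      one_zpow, one_mul, zpow_mul, zpow_natCast]
  · obtain ⟨c, hc⟩ := Nat.gcd_dvd_right (orderOf a) k
    refine ⟨c, ?_⟩
    change (a ^ Nat.gcd (orderOf a) k) ^ (c : ℤ) = _
    rw [zpow_natCast, ← pow_mul, ← hc]

/-- A cyclic group of order `m` has as many subgroups as `m` has divisors. -/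
lemma Subgroup.ncard_le_zpowers (a : G) (ha : 0 < orderOf a) :
    {H : Subgroup G | H ≤ zpowers a}.ncard = (orderOf a).divisors.card := by
  rw [← Set.ncard_coe_finset]
  symm
  refine Set.ncard_congr (fun d _ ↦ zpowers (a ^ d)) ?_ ?_ ?_
  · intro d _
    exact zpowers_le.2 (npow_mem_zpowers a d)
  · intro d e hd he h
    simp only [Finset.mem_coe, Nat.mem_divisors] at hd he
    have h' := congrArg (fun H : Subgroup G ↦ Nat.card H) h
    simp only [Nat.card_zpowers] at h'
    rw [orderOf_pow_of_dvd (Nat.pos_of_dvd_of_pos hd.1 ha).ne' hd.1,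
      orderOf_pow_of_dvd (Nat.pos_of_dvd_of_pos he.1 ha).ne' he.1] at h'
    rw [← Nat.div_div_self hd.1 ha.ne', h', Nat.div_div_self he.1 ha.ne']
  · intro H hH
    have : IsCyclic H := isCyclic_of_le hH
    obtain ⟨h, rfl⟩ := (Subgroup.isCyclic_iff_exists_zpowers_eq_top H).1 this
    have hfin : IsOfFinOrder a := orderOf_pos_iff.1 ha
    obtain ⟨k, rfl⟩ := hfin.mem_powers_iff_mem_zpowers.2 (zpowers_le.1 hH)
    exact ⟨Nat.gcd (orderOf a) k, Nat.mem_divisors.2 ⟨Nat.gcd_dvd_left _ _, ha.ne'⟩,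
      zpowers_pow_gcd_orderOf a k⟩

/-- Every subgroup of a cyclic normal subgroup is normal. -/
lemma Subgroup.normal_of_le_zpowers {a : G} (ha : (zpowers a).Normal) {H : Subgroup G}
    (hH : H ≤ zpowers a) : H.Normal := by
  refine ⟨fun h hh g ↦ ?_⟩
  obtain ⟨k, rfl⟩ := hH hh
  obtain ⟨s, hs⟩ := ha.conj_mem a (mem_zpowers a) g
  change g * a ^ k * g⁻¹ ∈ H
  rw [← conj_zpow, ← hs]
  change (a ^ s) ^ k ∈ H
  rw [zpow_comm]
  exact H.zpow_mem hh s

end CyclicSubgroups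

section PrimeQuotient

variable {G : Type*} [Group G] {n : ℕ} [hn : Fact n.Prime] (φ : G →* Multiplicative (ZMod n))

lemma orderOf_eq_of_notMem_ker (hφ : ∀ g ∉ φ.ker, g ^ n = 1) {g : G} (hg : g ∉ φ.ker) :
    orderOf g = n :=
  orderOf_eq_prime (hφ g hg) fun h ↦ hg (h ▸ φ.ker.one_mem)

/-- If all elements outside the kernel of a surjection onto a group of prime order `n` have
order `n`, the cyclic subgroups outside the kernel are counted by the elements of the kernel. -/
lemma ncard_isCyclic_not_le_ker (hφ : ∀ g ∉ φ.ker, g ^ n = 1) {b : G}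
    (hb : φ b = Multiplicative.ofAdd 1) :
    {H : Subgroup G | IsCyclic H ∧ ¬ H ≤ φ.ker}.ncard = Nat.card φ.ker := by
  have hbx : ∀ x ∈ φ.ker, φ (b * x) = Multiplicative.ofAdd 1 := fun x hx ↦ by
    rw [map_mul, hb, MonoidHom.mem_ker.1 hx, mul_one]
  have hbx' : ∀ x ∈ φ.ker, b * x ∉ φ.ker := fun x hx h ↦ by
    rw [MonoidHom.mem_ker, hbx x hx] at h
    exact one_ne_zero (α := ZMod n) h
  rw [← SetLike.coe_sort_coe, Nat.card_coe_set_eq]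
  symm
  refine Set.ncard_congr (fun x _ ↦ Subgroup.zpowers (b * x)) ?_ ?_ ?_
  · intro x hx
    exact ⟨inferInstance, fun h ↦ hbx' x hx (h (Subgroup.mem_zpowers _))⟩
  · intro x y hx hy h
    obtain ⟨t, ht⟩ : b * y ∈ Subgroup.zpowers (b * x) := by
      rw [h]; exact Subgroup.mem_zpowers _
    change (b * x) ^ t = b * y at ht
    have h1 := congrArg φ ht
    rw [map_zpow, hbx x hx, hbx y hy, ← ofAdd_zsmul] at h1
    have h2 : ((1 : ℤ) : ZMod n) = (t : ℤ) := by
      simpa using (Multiplicative.ofAdd.injective h1).symm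
    obtain ⟨s, hs⟩ := (ZMod.intCast_eq_intCast_iff_dvd_sub _ _ _).1 h2
    obtain rfl : t = 1 + n * s := by omega
    rw [zpow_add, zpow_mul, zpow_natCast, hφ _ (hbx' x hx), one_zpow, mul_one, zpow_one] at ht
    exact mul_left_cancel ht
  · rintro H ⟨hH, hHk⟩
    obtain ⟨g, rfl⟩ := (Subgroup.isCyclic_iff_exists_zpowers_eq_top H).1 hH
    have hg : g ∉ φ.ker := fun h ↦ hHk (Subgroup.zpowers_le.2 h)
    obtain ⟨z, hz⟩ : ∃ z, φ g = Multiplicative.ofAdd z := ⟨(φ g).toAdd, rfl⟩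
    have hz0 : z ≠ 0 := by
      rintro rfl
      exact hg hz
    have hgt : φ (g ^ (z⁻¹).val) = Multiplicative.ofAdd 1 := by
      rw [map_pow, hz, ← ofAdd_nsmul, nsmul_eq_mul, ZMod.natCast_zmod_val, inv_mul_cancel₀ hz0]
    refine ⟨b⁻¹ * g ^ (z⁻¹).val, ?_, ?_⟩
    · simp only [SetLike.mem_coe, MonoidHom.mem_ker]
      rw [map_mul, hgt, map_inv, hb, inv_mul_cancel]
    · rw [mul_inv_cancel_left]
      apply le_antisymm <;> rw [Subgroup.zpowers_le]
      · exact Subgroup.npow_mem_zpowers g _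
      · refine ⟨(z.val : ℕ), ?_⟩
        change (g ^ (z⁻¹).val) ^ ((z.val : ℕ) : ℤ) = g
        rw [zpow_natCast, ← pow_mul]
        conv_rhs => rw [← pow_one g]
        rw [pow_eq_pow_iff_modEq, orderOf_eq_of_notMem_ker φ hφ hg, ← ZMod.natCast_eq_natCast_iff]
        simp [inv_mul_cancel₀ hz0]

/-- Two permutable subgroups of prime order `n` coincide if `n ^ 2` does not divide the order of
the group. -/
lemma Subgroup.eq_of_mul_comm_of_card_eq_prime {H K : Subgroup G} (hH : Nat.card H = n)
    (hK : Nat.card K = n) (hG : ¬ n ^ 2 ∣ Nat.card G)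
    (hHK : (H : Set G) * (K : Set G) = (K : Set G) * (H : Set G)) : H = K := by
  by_contra hne
  have : Finite H := Nat.finite_of_card_ne_zero (hH ▸ hn.out.ne_zero)
  have : Finite K := Nat.finite_of_card_ne_zero (hK ▸ hn.out.ne_zero)
  have hdisj : Disjoint H K := by
    rw [disjoint_iff]
    rcases (Nat.dvd_prime hn.out).1 (hH ▸ card_dvd_of_le (inf_le_left : H ⊓ K ≤ H)) with h | h
    · exact card_eq_one.1 h
    · refine absurd ?_ hne
      rw [← eq_of_le_of_card_ge (inf_le_left : H ⊓ K ≤ H) (by omega),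
        eq_of_le_of_card_ge (inf_le_right : H ⊓ K ≤ K) (by omega)]
  let L : Subgroup G :=
    { carrier := (H : Set G) * (K : Set G)
      mul_mem' := fun {x y} hx hy ↦ by
        have : x * y ∈ ((H : Set G) * K) * ((H : Set G) * K) := Set.mul_mem_mul hx hy
        rwa [mul_assoc, ← mul_assoc (K : Set G), ← hHK, mul_assoc, coe_mul_coe, ← mul_assoc,
          coe_mul_coe] at this
      one_mem' := ⟨1, H.one_mem, 1, K.one_mem, mul_one 1⟩
      inv_mem' := by
        rintro _ ⟨h, hh, k, hk, rfl⟩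
        rw [hHK]
        exact ⟨k⁻¹, K.inv_mem hk, h⁻¹, H.inv_mem hh, (mul_inv_rev h k).symm⟩ }
  have hL : Nat.card L = n ^ 2 := by
    have : Nat.card L = Nat.card (H × K) := by
      refine (Nat.card_eq_of_bijective
        (fun p : H × K ↦ (⟨p.1 * p.2, Set.mul_mem_mul p.1.2 p.2.2⟩ : L)) ⟨?_, ?_⟩).symm
      · intro p q h
        exact mul_injective_of_disjoint hdisj (congrArg Subtype.val h)
      · rintro ⟨_, h, hh, k, hk, rfl⟩
        exact ⟨(⟨h, hh⟩, ⟨k, hk⟩), rfl⟩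
    rw [this, Nat.card_prod, hH, hK, sq]
  exact hG (hL ▸ card_subgroup_dvd_card L)

end PrimeQuotient

section Counting

variable {G : Type*} [Group G] {n : ℕ} [hn : Fact n.Prime] {φ : G →* Multiplicative (ZMod n)}
  {a b : G}

/-- The counts of cyclic subgroups and of permuting pairs of cyclic subgroups in a group `G` with
a finite cyclic normal subgroup `⟨a⟩` of prime index `n` outside of which all elements have
order `n`. -/
lemma card_isCyclic_and_card_permuting (ha : 0 < orderOf a) (hcop : (orderOf a).Coprime n)
    (hker : φ.ker = Subgroup.zpowers a) (hb : φ b = Multiplicative.ofAdd 1)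
    (hφ : ∀ g ∉ φ.ker, g ^ n = 1) :
    {H : Subgroup G | IsCyclic H}.ncard = (orderOf a).divisors.card + orderOf a ∧
    {p : Subgroup G × Subgroup G | IsCyclic p.1 ∧ IsCyclic p.2 ∧
        (p.1 : Set G) * (p.2 : Set G) = (p.2 : Set G) * (p.1 : Set G)}.ncard =
      (orderOf a).divisors.card * ((orderOf a).divisors.card + orderOf a) +
        orderOf a * ((orderOf a).divisors.card + 1) := by
  set A : Set (Subgroup G) := {H | H ≤ Subgroup.zpowers a} with hA
  set B : Set (Subgroup G) := {H | IsCyclic H ∧ ¬ H ≤ φ.ker} with hB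
  have cA : A.ncard = (orderOf a).divisors.card := Subgroup.ncard_le_zpowers a ha
  have cB : B.ncard = orderOf a := by
    rw [hB, ncard_isCyclic_not_le_ker φ hφ hb, hker, Nat.card_zpowers]
  have fA : A.Finite := Set.finite_of_ncard_pos (by
    rw [cA]; exact Finset.card_pos.2 (Nat.nonempty_divisors.2 ha.ne'))
  have fB : B.Finite := Set.finite_of_ncard_pos (by rwa [cB])
  have dAB : Disjoint A B := Set.disjoint_left.2 fun H hH hH' ↦ hH'.2 (hker ▸ hH)
  have hcyc : {H : Subgroup G | IsCyclic H} = A ∪ B := by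
    ext H
    constructor
    · intro hH
      by_cases h : H ≤ φ.ker
      · exact Or.inl (h.trans hker.le)
      · exact Or.inr ⟨hH, h⟩
    · rintro (h | h)
      · exact Subgroup.isCyclic_of_le h
      · exact h.1
  have hnormal : ∀ H ∈ A, H.Normal := fun H hH ↦
    Subgroup.normal_of_le_zpowers (hker ▸ inferInstance) hH
  have hcardB : ∀ H ∈ B, Nat.card H = n := by
    rintro H ⟨hH, hHk⟩
    obtain ⟨g, rfl⟩ := (Subgroup.isCyclic_iff_exists_zpowers_eq_top H).1 hH
    rw [Nat.card_zpowers]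
    exact orderOf_eq_of_notMem_ker φ hφ fun h ↦ hHk (Subgroup.zpowers_le.2 h)
  have hG : ¬ n ^ 2 ∣ Nat.card G := by
    intro h
    rw [← φ.ker.card_mul_index, hker, Nat.card_zpowers, ← hker, Subgroup.index_ker] at h
    have h1 : Nat.card φ.range ∣ n := by
      simpa using Subgroup.card_subgroup_dvd_card φ.range
    have h2 : n * n ∣ orderOf a * n := sq n ▸ h.trans (mul_dvd_mul_left _ h1)
    have h3 : n ∣ orderOf a := Nat.dvd_of_mul_dvd_mul_right hn.out.pos h2
    exact hn.out.one_lt.ne' (Nat.eq_one_of_dvd_coprimes hcop h3 dvd_rfl)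
  have hpairs : {p : Subgroup G × Subgroup G | IsCyclic p.1 ∧ IsCyclic p.2 ∧
        (p.1 : Set G) * (p.2 : Set G) = (p.2 : Set G) * (p.1 : Set G)} =
      A ×ˢ (A ∪ B) ∪ (B ×ˢ A ∪ (fun H ↦ (H, H)) '' B) := by
    ext ⟨H, K⟩
    constructor
    · rintro ⟨hH, hK, hHK⟩
      have hH' : H ∈ A ∪ B := hcyc ▸ hH
      have hK' : K ∈ A ∪ B := hcyc ▸ hK
      rcases hH' with hH' | hH'
      · exact Or.inl ⟨hH', hK'⟩
      rcases hK' with hK' | hK'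
      · exact Or.inr (Or.inl ⟨hH', hK'⟩)
      · have := Subgroup.eq_of_mul_comm_of_card_eq_prime (hcardB H hH') (hcardB K hK') hG hHK
        exact Or.inr (Or.inr ⟨H, hH', by rw [this]⟩)
    · have hcycA : ∀ H ∈ A, IsCyclic H := fun H hH ↦ Subgroup.isCyclic_of_le hH
      rintro (⟨hH, hK⟩ | ⟨hH, hK⟩ | ⟨H', hH', h⟩)
      · have := hnormal H hH
        have hK' : IsCyclic K := by
          have : K ∈ {H : Subgroup G | IsCyclic H} := hcyc ▸ hK
          exact this
        refine ⟨hcycA H hH, hK', ?_⟩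
        change (H : Set G) * (K : Set G) = (K : Set G) * (H : Set G)
        rw [← Subgroup.normal_mul, ← Subgroup.mul_normal, sup_comm]
      · have := hnormal K hK
        refine ⟨hH.1, hcycA K hK, ?_⟩
        change (H : Set G) * (K : Set G) = (K : Set G) * (H : Set G)
        rw [← Subgroup.mul_normal, ← Subgroup.normal_mul, sup_comm]
      · obtain ⟨rfl, rfl⟩ := Prod.mk.inj h
        exact ⟨hH'.1, hH'.1, rfl⟩
  have cAB : (A ∪ B).ncard = (orderOf a).divisors.card + orderOf a := by
    rw [Set.ncard_union_eq dAB fA fB, cA, cB]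
  refine ⟨hcyc ▸ cAB, ?_⟩
  have d2 : Disjoint (B ×ˢ A) ((fun H ↦ (H, H)) '' B) := by
    rw [Set.disjoint_left]
    rintro _ ⟨-, h⟩ ⟨H, hH, rfl⟩
    exact Set.disjoint_left.1 dAB h hH
  have d1 : Disjoint (A ×ˢ (A ∪ B)) (B ×ˢ A ∪ (fun H ↦ (H, H)) '' B) := by
    rw [Set.disjoint_left]
    rintro _ ⟨h, -⟩ (⟨h', -⟩ | ⟨H, hH, rfl⟩)
    · exact Set.disjoint_left.1 dAB h h'
    · exact Set.disjoint_left.1 dAB h hH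
  rw [hpairs, Set.ncard_union_eq d1 (fA.prod (fA.union fB)) ((fB.prod fA).union (fB.image _)),
    Set.ncard_union_eq d2 (fB.prod fA) (fB.image _), Set.ncard_prod, Set.ncard_prod, cAB,
    Set.ncard_image_of_injective _ fun H K h ↦ (Prod.mk.inj h).1, cA, cB, mul_add_one]

end Counting

section ZM

variable {m n r : ℕ}

lemma za_pow : za m n r ^ m = 1 :=
  PresentedGroup.one_of_mem (rels := ZMrel m n r) (x := FreeGroup.of 0 ^ m) (by simp [ZMrel])

lemma zb_pow : zb m n r ^ n = 1 :=
  PresentedGroup.one_of_mem (rels := ZMrel m n r) (x := FreeGroup.of 1 ^ n) (by simp [ZMrel])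

lemma zb_inv_mul_za_mul_zb : (zb m n r)⁻¹ * za m n r * zb m n r = za m n r ^ r :=
  mul_inv_eq_one.1 <| PresentedGroup.one_of_mem (rels := ZMrel m n r)
    (x := (FreeGroup.of 1)⁻¹ * FreeGroup.of 0 * FreeGroup.of 1 * (FreeGroup.of 0 ^ r)⁻¹)
    (by simp [ZMrel])

lemma zb_pow_inv_mul_za_mul_zb_pow (j : ℕ) :
    (zb m n r ^ j)⁻¹ * za m n r * zb m n r ^ j = za m n r ^ r ^ j := by
  induction j with
  | zero => simp
  | succ j ih =>
    calc (zb m n r ^ (j + 1))⁻¹ * za m n r * zb m n r ^ (j + 1)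
        = (zb m n r)⁻¹ * ((zb m n r ^ j)⁻¹ * za m n r * zb m n r ^ j) * zb m n r := by
          rw [pow_succ]; group
      _ = ((zb m n r)⁻¹ * za m n r * zb m n r) ^ r ^ j := by
          rw [ih]
          simpa using (conj_pow (i := r ^ j) (a := (zb m n r)⁻¹) (b := za m n r)).symm
      _ = za m n r ^ r ^ (j + 1) := by
          rw [zb_inv_mul_za_mul_zb, ← pow_mul, pow_succ']

/-- The homomorphism out of `ZM m n r` determined by images of the generators. -/
def ZM.lift {Q : Type*} [Group Q] (x y : Q) (hx : x ^ m = 1) (hy : y ^ n = 1)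
    (hxy : y⁻¹ * x * y = x ^ r) : ZM m n r →* Q :=
  PresentedGroup.toGroup (f := ![x, y]) <| by
    rintro _ (rfl | rfl | rfl) <;> simp [hx, hy, hxy]

lemma ZM.lift_za {Q : Type*} [Group Q] {x y : Q} (hx : x ^ m = 1) (hy : y ^ n = 1)
    (hxy : y⁻¹ * x * y = x ^ r) : ZM.lift x y hx hy hxy (za m n r) = x :=
  PresentedGroup.toGroup.of _

lemma ZM.lift_zb {Q : Type*} [Group Q] {x y : Q} (hx : x ^ m = 1) (hy : y ^ n = 1)
    (hxy : y⁻¹ * x * y = x ^ r) : ZM.lift x y hx hy hxy (zb m n r) = y :=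
  PresentedGroup.toGroup.of _

/-- The order of `a` is read off from the action of `ZM m n r` on `ZMod m` by affine maps. -/
lemma orderOf_za (hn : n ≠ 0) (hr : r ^ n ≡ 1 [MOD m]) : orderOf (za m n r) = m := by
  refine Nat.dvd_antisymm (orderOf_dvd_of_pow_eq_one za_pow) ?_
  have hr' : (r : ZMod m) ^ n = 1 := by
    exact_mod_cast (ZMod.natCast_eq_natCast_iff _ _ _).2 hr
  let u : (ZMod m)ˣ := Units.ofPowEqOne (r : ZMod m) n hr' hn
  have hu : u ^ n = 1 := Units.pow_ofPowEqOne hr' hn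
  let ψ : ZM m n r →* Equiv.Perm (ZMod m) :=
    ZM.lift (Equiv.addRight 1) (MulAction.toPermHom _ (ZMod m) u⁻¹)
      (by ext x; simp) (by rw [← map_pow, inv_pow, hu, inv_one, map_one])
      (by
        rw [← map_inv, inv_inv]
        ext x
        have : (u : ZMod m) = r := rfl
        simp [Equiv.Perm.mul_apply, Units.smul_def, ← this])
  have h := congrArg ψ (pow_orderOf_eq_one (za m n r))
  rw [map_pow, ZM.lift_za, map_one] at h
  have h0 := congrArg (fun σ : Equiv.Perm (ZMod m) ↦ σ 0) h
  simpa [ZMod.natCast_eq_zero_iff] using h0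

lemma normal_zpowers_za (hn : n ≠ 0) : (Subgroup.zpowers (za m n r)).Normal := by
  have hconj : ∀ (j : ℕ), ∀ h ∈ Subgroup.zpowers (za m n r),
      (zb m n r ^ j)⁻¹ * h * zb m n r ^ j ∈ Subgroup.zpowers (za m n r) := by
    rintro j _ ⟨k, rfl⟩
    have := conj_zpow (i := k) (a := (zb m n r ^ j)⁻¹) (b := za m n r)
    rw [inv_inv, zb_pow_inv_mul_za_mul_zb_pow] at this
    exact this ▸ Subgroup.zpow_mem _ (Subgroup.npow_mem_zpowers _ _) _
  have hinv : (zb m n r ^ (n - 1))⁻¹ = zb m n r := by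
    rw [inv_eq_iff_mul_eq_one, ← pow_succ, Nat.sub_add_cancel (Nat.pos_of_ne_zero hn), zb_pow]
  rw [← Subgroup.normalizer_eq_top_iff, eq_top_iff]
  intro g _
  refine PresentedGroup.generated_by _ _ (fun i ↦ ?_) g
  fin_cases i
  · exact Subgroup.le_normalizer (Subgroup.mem_zpowers (za m n r))
  · refine Subgroup.mem_normalizer_iff.2 fun h ↦ ⟨fun hh ↦ ?_, fun hh ↦ ?_⟩
    · have := hconj (n - 1) h hh
      rw [hinv] at this
      rwa [← inv_inv (zb m n r ^ (n - 1)), hinv] at this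
    · have := hconj 1 _ hh
      change (zb m n r ^ 1)⁻¹ * (zb m n r * h * (zb m n r)⁻¹) * zb m n r ^ 1 ∈ _ at this
      simpa [mul_assoc] using this

/-- Every element of `ZM m n r` has the form `b ^ j * a ^ i`. -/
lemma exists_eq_zb_pow_mul_za_zpow (hn : n ≠ 0) (g : ZM m n r) :
    ∃ (j : ℕ) (i : ℤ), g = zb m n r ^ j * za m n r ^ i := by
  have := normal_zpowers_za (m := m) (r := r) hn
  have hg : g ∈ Subgroup.zpowers (zb m n r) ⊔ Subgroup.zpowers (za m n r) := by
    refine PresentedGroup.generated_by _ _ (fun i ↦ ?_) g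
    fin_cases i
    · exact Subgroup.mem_sup_right (Subgroup.mem_zpowers (za m n r))
    · exact Subgroup.mem_sup_left (Subgroup.mem_zpowers (zb m n r))
  obtain ⟨x, hx, _, ⟨i, rfl⟩, rfl⟩ := Subgroup.mem_sup_of_normal_right.1 hg
  have hfin : IsOfFinOrder (zb m n r) :=
    isOfFinOrder_iff_pow_eq_one.2 ⟨n, Nat.pos_of_ne_zero hn, zb_pow⟩
  obtain ⟨j, rfl⟩ := hfin.mem_powers_iff_mem_zpowers.2 hx
  exact ⟨j, i, rfl⟩

/-- The projection of `ZM m n r` to its quotient of order `n`. -/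
def ZM.proj (m n r : ℕ) : ZM m n r →* Multiplicative (ZMod n) :=
  ZM.lift 1 (Multiplicative.ofAdd 1) (one_pow m) (by rw [← ofAdd_nsmul]; simp) (by simp)

lemma ZM.proj_zb_pow_mul_za_zpow (j : ℕ) (i : ℤ) :
    ZM.proj m n r (zb m n r ^ j * za m n r ^ i) = Multiplicative.ofAdd (j : ZMod n) := by
  rw [map_mul, map_pow, map_zpow, ZM.proj, ZM.lift_za, ZM.lift_zb, ← ofAdd_nsmul]
  simp

lemma ZM.zb_pow_mul_za_zpow_mem_ker_proj (j : ℕ) (i : ℤ) :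
    zb m n r ^ j * za m n r ^ i ∈ (ZM.proj m n r).ker ↔ n ∣ j := by
  rw [MonoidHom.mem_ker, ZM.proj_zb_pow_mul_za_zpow, ofAdd_eq_one, ZMod.natCast_eq_zero_iff]

lemma ZM.ker_proj (hn : n ≠ 0) : (ZM.proj m n r).ker = Subgroup.zpowers (za m n r) := by
  apply le_antisymm
  · intro g hg
    obtain ⟨j, i, rfl⟩ := exists_eq_zb_pow_mul_za_zpow hn g
    obtain ⟨c, rfl⟩ := (ZM.zb_pow_mul_za_zpow_mem_ker_proj j i).1 hg
    rw [pow_mul, zb_pow, one_pow, one_mul]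
    exact Subgroup.zpow_mem_zpowers _ _
  · rw [Subgroup.zpowers_le, MonoidHom.mem_ker, ZM.proj, ZM.lift_za]

lemma coprime_pow_sub_one {m n r j : ℕ} (hr : 0 < r) (h2 : m.Coprime (r - 1))
    (h3 : r ^ n ≡ 1 [MOD m]) (hj : n.Coprime j) : m.Coprime (r ^ j - 1) := by
  have hd : m ∣ r ^ n - 1 := (Nat.modEq_iff_dvd' (Nat.one_le_pow _ _ hr)).1 h3.symm
  refine Nat.Coprime.symm (Nat.eq_one_of_dvd_coprimes h2 (Nat.gcd_dvd_right _ _) ?_)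
  have := Nat.dvd_gcd ((Nat.gcd_dvd_right (r ^ j - 1) m).trans hd) (Nat.gcd_dvd_left (r ^ j - 1) m)
  rwa [Nat.pow_sub_one_gcd_pow_sub_one, hj, pow_one] at this

/-- Elements outside `⟨a⟩` act on `⟨a⟩` without fixed points, hence have order dividing `n`. -/
lemma ZM.pow_eq_one_of_notMem_ker_proj (hr : 0 < r) (hn : n.Prime) (h2 : m.Coprime (r - 1))
    (h3 : r ^ n ≡ 1 [MOD m]) {g : ZM m n r} (hg : g ∉ (ZM.proj m n r).ker) : g ^ n = 1 := by
  have hgn : g ^ n ∈ (ZM.proj m n r).ker := by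
    obtain ⟨z, hz⟩ : ∃ z, ZM.proj m n r g = Multiplicative.ofAdd z := ⟨_, rfl⟩
    rw [MonoidHom.mem_ker, map_pow, hz, ← ofAdd_nsmul]
    simp
  rw [ZM.ker_proj hn.ne_zero] at hgn
  obtain ⟨k, hk⟩ := hgn
  change za m n r ^ k = g ^ n at hk
  obtain ⟨j, i, hji⟩ := exists_eq_zb_pow_mul_za_zpow hn.ne_zero g
  have hj : ¬ n ∣ j := fun h ↦ hg (hji ▸ (ZM.zb_pow_mul_za_zpow_mem_ker_proj j i).2 h)
  have hconj : g⁻¹ * za m n r * g = za m n r ^ r ^ j := by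
    rw [hji, mul_inv_rev, show ∀ x y z : ZM m n r, x⁻¹ * y⁻¹ * z * (y * x) =
      x⁻¹ * (y⁻¹ * z * y) * x from fun x y z ↦ by group, zb_pow_inv_mul_za_mul_zb_pow, ← zpow_neg,
      ← zpow_natCast, ← zpow_add, ← zpow_add]
    congr 1
    ring
  have hfix : g⁻¹ * za m n r ^ k * g = za m n r ^ k := by
    rw [hk, mul_assoc, ← pow_succ, pow_succ', inv_mul_cancel_left]
  have hpow : za m n r ^ (k * ((r ^ j - 1 : ℕ) : ℤ)) = 1 := by
    have h := conj_zpow (i := k) (a := g⁻¹) (b := za m n r)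
    rw [inv_inv, hconj, hfix, ← zpow_natCast, ← zpow_mul] at h
    rw [Nat.cast_sub (Nat.one_le_pow _ _ hr), mul_sub, zpow_sub, mul_comm, h]
    simp
  rw [← orderOf_dvd_iff_zpow_eq_one, orderOf_za hn.ne_zero h3] at hpow
  have hcop : IsCoprime (m : ℤ) ((r ^ j - 1 : ℕ) : ℤ) :=
    Nat.isCoprime_iff_coprime.2 (coprime_pow_sub_one hr h2 h3 ((hn.coprime_iff_not_dvd).2 hj))
  obtain ⟨c, rfl⟩ := hcop.dvd_of_dvd_mul_right hpow
  rw [← hk, zpow_mul, zpow_natCast, za_pow, one_zpow]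

end ZM

/-- For `n` prime, the cyclic subgroup commutativity degree of `ZM(m,n,r)` is
`(τ(m)(τ(m)+m) + m(τ(m)+1)) / (τ(m)+m)²`. -/
theorem csd_ZM_of_prime (m n r : ℕ)
    (hm : 0 < m) (hr : 0 < r) (hnp : n.Prime)
    (h1 : Nat.gcd m n = 1) (h2 : Nat.gcd m (r - 1) = 1) (h3 : r ^ n ≡ 1 [MOD m]) :
    (Nat.card {p : Subgroup (ZM m n r) × Subgroup (ZM m n r) //
        IsCyclic p.1 ∧ IsCyclic p.2 ∧
          (p.1 : Set (ZM m n r)) * (p.2 : Set (ZM m n r)) =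
            (p.2 : Set (ZM m n r)) * (p.1 : Set (ZM m n r))} : ℚ) /
      (Nat.card {H : Subgroup (ZM m n r) // IsCyclic H} : ℚ) ^ 2 =
    ((m.divisors.card : ℚ) * ((m.divisors.card : ℚ) + (m : ℚ)) +
        (m : ℚ) * ((m.divisors.card : ℚ) + 1)) /
      ((m.divisors.card : ℚ) + (m : ℚ)) ^ 2 := by
  have : Fact n.Prime := ⟨hnp⟩
  have ho : orderOf (za m n r) = m := orderOf_za hnp.ne_zero h3
  have hb : ZM.proj m n r (zb m n r) = Multiplicative.ofAdd 1 := ZM.lift_zb _ _ _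
  obtain ⟨hc, hp⟩ := card_isCyclic_and_card_permuting (a := za m n r) (by rwa [ho])
    (by rwa [ho]) (ZM.ker_proj hnp.ne_zero) hb
    fun g hg ↦ ZM.pow_eq_one_of_notMem_ker_proj hr hnp h2 h3 hg
  rw [ho, ← Nat.card_coe_set_eq] at hc hp
  rw [Set.coe_ofPred] at hc hp
  rw [hc, hp]
  push_cast
  rfl
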